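/- Let α > 1, T > 0, let f be the Bessel kernel on ℝ³, and let 0 < γ' < min(α−1, 2). Then there exists a constant C > 0 such that for all y ∈ ℝ³, ∫_{|z| ≤ 2T} |f(z+y) + f(z−y) − 2f(z)| / |z| dz ≤ C |y|^{γ'}. -/

import Mathlib

open MeasureTheory Real
open scoped ENNReal

noncomputable section

abbrev E3 : Type := EuclideanSpace ℝ (Fin 3)

/-- The Bessel kernel on `ℝ³` with parameter `α`:
`f(x) = ∫₀^∞ w^{(α-5)/2} e^{-w} e^{-|x|²/(4w)} dw`. -/
def besselKernel (α : ℝ) (x : E3) : ℝ :=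
  ∫ w in Set.Ioi (0 : ℝ), w ^ ((α - 5) / 2) * Real.exp (-w) * Real.exp (-‖x‖ ^ 2 / (4 * w))

/-- The Gaussian `x ↦ e^{-|x|²/(4w)}` on `ℝ³`. -/
def gaussianProfile (w : ℝ) (x : E3) : ℝ := Real.exp (-‖x‖ ^ 2 / (4 * w))

/-- The second difference with step `y` of the Gaussian `e^{-|·|²/(4w)}`. -/
def gaussianDiff (w : ℝ) (y z : E3) : ℝ :=
  gaussianProfile w (z + y) + gaussianProfile w (z - y) - 2 * gaussianProfile w z

lemma gaussianProfile_pos (w : ℝ) (x : E3) : 0 < gaussianProfile w x := Real.exp_pos _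

lemma gaussianProfile_smul {s : ℝ} (hs : 0 < s) (u : E3) :
    gaussianProfile (s ^ 2) (s • u) = gaussianProfile 1 u := by
  unfold gaussianProfile
  rw [norm_smul, Real.norm_of_nonneg hs.le]
  congr 1
  field_simp

lemma gaussianDiff_smul {s : ℝ} (hs : 0 < s) (v u : E3) :
    gaussianDiff (s ^ 2) (s • v) (s • u) = gaussianDiff 1 v u := by
  unfold gaussianDiff
  rw [← smul_add, ← smul_sub, gaussianProfile_smul hs, gaussianProfile_smul hs,
    gaussianProfile_smul hs]

lemma gaussianProfile_one_le_four (x : E3) : gaussianProfile 1 x ≤ gaussianProfile 4 x := by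
  unfold gaussianProfile
  apply Real.exp_le_exp.2
  nlinarith [sq_nonneg ‖x‖]

lemma abs_gaussianDiff_one_le_sq (v u : E3) (hv : ‖v‖ ≤ 1) :
    |gaussianDiff 1 v u| ≤ ‖v‖ ^ 2 * (7 * gaussianProfile 4 u) := by
  set A := ‖u‖ with hA
  set B := ‖v‖ with hB
  set c := inner ℝ u v with hc
  have hA0 : 0 ≤ A := norm_nonneg u
  have hB0 : 0 ≤ B := norm_nonneg v
  have hcAB : c ^ 2 ≤ A ^ 2 * B ^ 2 := by
    have h : |c| ≤ A * B := abs_real_inner_le_norm u v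
    calc c ^ 2 = |c| ^ 2 := (sq_abs c).symm
      _ ≤ (A * B) ^ 2 := by gcongr
      _ = A ^ 2 * B ^ 2 := by ring
  have hform : gaussianDiff 1 v u
      = Real.exp (-A ^ 2 / 4) * (2 * Real.exp (-B ^ 2 / 4) * Real.cosh (c / 2) - 2) := by
    unfold gaussianDiff gaussianProfile
    rw [norm_add_sq_real, norm_sub_sq_real, Real.cosh_eq]
    have e1 : -(‖u‖ ^ 2 + 2 * inner ℝ u v + ‖v‖ ^ 2) / (4 * 1)
        = -A ^ 2 / 4 + (-B ^ 2 / 4) + (-(c / 2)) := by rw [hA, hB, hc]; ring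
    have e2 : -(‖u‖ ^ 2 - 2 * inner ℝ u v + ‖v‖ ^ 2) / (4 * 1)
        = -A ^ 2 / 4 + (-B ^ 2 / 4) + c / 2 := by rw [hA, hB, hc]; ring
    rw [e1, e2, Real.exp_add, Real.exp_add, Real.exp_add (-A ^ 2 / 4 + -B ^ 2 / 4) (c / 2),
      Real.exp_add, ← hA, mul_one]
    ring
  have hcosh1 : 1 ≤ Real.cosh (c / 2) := Real.one_le_cosh _
  have hcosh : Real.cosh (c / 2) ≤ Real.exp (c ^ 2 / 8) := by
    refine (Real.cosh_le_exp_half_sq _).trans (le_of_eq ?_)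
    congr 1; ring
  have hB1 : Real.exp (-B ^ 2 / 4) ≤ 1 := Real.exp_le_one_iff.2 (by nlinarith)
  have hB2 : 1 - B ^ 2 / 4 ≤ Real.exp (-B ^ 2 / 4) := by
    linarith [Real.add_one_le_exp (-B ^ 2 / 4)]
  have hB2' := Real.exp_pos (-B ^ 2 / 4)
  have hexp : Real.exp (c ^ 2 / 8) - 1 ≤ A ^ 2 * B ^ 2 / 8 * Real.exp (A ^ 2 / 8) := by
    have h1 : Real.exp (c ^ 2 / 8) - 1 ≤ c ^ 2 / 8 * Real.exp (c ^ 2 / 8) := by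
      have h := Real.add_one_le_exp (-(c ^ 2 / 8))
      have h' : Real.exp (-(c ^ 2 / 8)) * Real.exp (c ^ 2 / 8) = 1 := by
        rw [← Real.exp_add]; simp
      nlinarith [Real.exp_pos (c ^ 2 / 8)]
    have h2 : c ^ 2 ≤ A ^ 2 := hcAB.trans
      (mul_le_of_le_one_right (sq_nonneg A) (pow_le_one₀ hB0 hv))
    refine h1.trans ?_
    gcongr
  have hbr : |2 * Real.exp (-B ^ 2 / 4) * Real.cosh (c / 2) - 2|
      ≤ B ^ 2 * (A ^ 2 / 4 * Real.exp (A ^ 2 / 8) + 1 / 2) := by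
    have hX : 0 ≤ A ^ 2 * B ^ 2 / 8 * Real.exp (A ^ 2 / 8) := by positivity
    rw [abs_le]
    constructor <;> nlinarith [sq_nonneg B]
  have hu : gaussianProfile 4 u = Real.exp (-A ^ 2 / 16) := by
    unfold gaussianProfile; rw [← hA]; norm_num
  have hexp1 : Real.exp (-A ^ 2 / 4) * Real.exp (A ^ 2 / 8)
      = Real.exp (-A ^ 2 / 16) * Real.exp (-A ^ 2 / 16) := by
    rw [← Real.exp_add, ← Real.exp_add]; congr 1; ring
  have hexp2 : A ^ 2 / 16 * Real.exp (-A ^ 2 / 16) ≤ 1 := by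
    have h := Real.add_one_le_exp (A ^ 2 / 16)
    have h' : Real.exp (A ^ 2 / 16) * Real.exp (-A ^ 2 / 16) = 1 := by
      rw [← Real.exp_add]; simp [neg_div]
    nlinarith [Real.exp_pos (-A ^ 2 / 16)]
  have hexp3 : Real.exp (-A ^ 2 / 4) ≤ Real.exp (-A ^ 2 / 16) :=
    Real.exp_le_exp.2 (by nlinarith)
  rw [hform, abs_mul, abs_of_pos (Real.exp_pos _), hu]
  calc Real.exp (-A ^ 2 / 4) * |2 * Real.exp (-B ^ 2 / 4) * Real.cosh (c / 2) - 2|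
      ≤ Real.exp (-A ^ 2 / 4) * (B ^ 2 * (A ^ 2 / 4 * Real.exp (A ^ 2 / 8) + 1 / 2)) := by gcongr
    _ = B ^ 2 * (4 * (A ^ 2 / 16 * Real.exp (-A ^ 2 / 16)) * Real.exp (-A ^ 2 / 16)
          + 1 / 2 * Real.exp (-A ^ 2 / 4)) := by
        linear_combination B ^ 2 * A ^ 2 / 4 * hexp1
    _ ≤ B ^ 2 * (4 * 1 * Real.exp (-A ^ 2 / 16) + 1 / 2 * Real.exp (-A ^ 2 / 16)) := by gcongr
    _ ≤ B ^ 2 * (7 * Real.exp (-A ^ 2 / 16)) := by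
        gcongr
        linarith [Real.exp_pos (-A ^ 2 / 16)]

lemma abs_gaussianDiff_one_le {γ : ℝ} (hγ0 : 0 < γ) (hγ2 : γ ≤ 2) (v u : E3) :
    |gaussianDiff 1 v u| ≤ ‖v‖ ^ γ *
      (gaussianProfile 4 (u + v) + gaussianProfile 4 (u + -v) + 7 * gaussianProfile 4 u) := by
  have h1 := gaussianProfile_pos 4 (u + v)
  have h2 := gaussianProfile_pos 4 (u + -v)
  have h3 := gaussianProfile_pos 4 u
  rcases le_total ‖v‖ 1 with hv | hv
  · have hpow : ‖v‖ ^ 2 ≤ ‖v‖ ^ γ := by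
      rw [← Real.rpow_two]
      exact Real.rpow_le_rpow_of_exponent_ge' (norm_nonneg v) hv hγ0.le hγ2
    refine (abs_gaussianDiff_one_le_sq v u hv).trans ?_
    gcongr
    linarith
  · have hpow : 1 ≤ ‖v‖ ^ γ := Real.one_le_rpow hv hγ0.le
    refine le_trans ?_ (le_mul_of_one_le_left (by positivity) hpow)
    have g1 := gaussianProfile_one_le_four (u + v)
    have g2 := gaussianProfile_one_le_four (u + -v)
    have g3 := gaussianProfile_one_le_four u
    have p1 := gaussianProfile_pos 1 (u + v)
    have p2 := gaussianProfile_pos 1 (u + -v)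
    have p3 := gaussianProfile_pos 1 u
    unfold gaussianDiff
    rw [sub_eq_add_neg u v, abs_le]
    constructor <;> linarith

lemma lintegral_gaussianProfile_four_lt_top :
    ∫⁻ u : E3, ENNReal.ofReal (gaussianProfile 4 u) < ∞ := by
  have h : Integrable (fun u : E3 => gaussianProfile 4 u) := by
    have h := (GaussianFourier.integrable_cexp_neg_mul_sq_norm_add (V := E3) (b := 1 / 16)
      (by norm_num) 0 0).norm
    refine h.congr (Filter.Eventually.of_forall fun u => ?_)
    simp only [Complex.norm_exp, gaussianProfile]
    congr 1
    have : (-(1 / 16 : ℂ) * (‖u‖ : ℂ) ^ 2 + 0 * (inner ℝ 0 u : ℝ))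
        = ((-‖u‖ ^ 2 / (4 * 4) : ℝ) : ℂ) := by push_cast; ring
    rw [this, Complex.ofReal_re]
  exact h.lintegral_lt_top

lemma lintegral_ball_inv_norm_lt_top :
    ∫⁻ u in Metric.ball (0 : E3) 1, ENNReal.ofReal (‖u‖⁻¹) < ∞ := by
  have h : IntegrableOn (fun u : E3 => ‖u‖⁻¹) (Metric.ball 0 1) := by
    refine (integrableOn_fun_norm_addHaar volume (f := fun r : ℝ => r⁻¹)).2 ?_
    rw [finrank_euclideanSpace_fin]
    have hid : IntegrableOn (fun r : ℝ => r) (Set.Ioo 0 1) :=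
      (continuous_id.integrableOn_Icc (a := 0) (b := 1)).mono_set Set.Ioo_subset_Icc_self
    refine hid.congr_fun (fun r hr => ?_) measurableSet_Ioo
    have : r ≠ 0 := hr.1.ne'
    simp only [smul_eq_mul]
    field_simp
  exact h.lintegral_lt_top

lemma exists_lintegral_gaussianProfile_div_norm_le :
    ∃ K : ℝ≥0∞, K ≠ ∞ ∧ ∀ a : E3,
      ∫⁻ u : E3, ENNReal.ofReal (gaussianProfile 4 (u + a) / ‖u‖) ≤ K := by
  refine ⟨(∫⁻ u in Metric.ball (0 : E3) 1, ENNReal.ofReal (‖u‖⁻¹))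
    + ∫⁻ u : E3, ENNReal.ofReal (gaussianProfile 4 u),
    (ENNReal.add_lt_top.2 ⟨lintegral_ball_inv_norm_lt_top,
      lintegral_gaussianProfile_four_lt_top⟩).ne, fun a => ?_⟩
  rw [← lintegral_add_right_eq_self (fun u : E3 => ENNReal.ofReal (gaussianProfile 4 u)) a,
    ← lintegral_indicator measurableSet_ball, ← lintegral_add_left]
  · refine lintegral_mono fun u => ?_
    by_cases hu : u ∈ Metric.ball (0 : E3) 1
    · rw [Set.indicator_of_mem hu]
      refine le_add_right (ENNReal.ofReal_le_ofReal ?_)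
      rw [div_eq_mul_inv]
      refine mul_le_of_le_one_left (by positivity) ?_
      unfold gaussianProfile
      refine Real.exp_le_one_iff.2 ?_
      rw [neg_div]
      exact neg_nonpos.2 (by positivity)
    · refine le_add_left (ENNReal.ofReal_le_ofReal ?_)
      rw [mem_ball_zero_iff, not_lt] at hu
      exact div_le_self (gaussianProfile_pos _ _).le hu
  · exact Measurable.indicator (by fun_prop) measurableSet_ball

lemma lintegral_eq_ofReal_pow_three_mul_lintegral_smul {s : ℝ} (hs : 0 < s) {F : E3 → ℝ≥0∞}
    (hF : Measurable F) :
    ∫⁻ z, F z = ENNReal.ofReal (s ^ 3) * ∫⁻ u, F (s • u) := by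
  have h := lintegral_map (μ := (volume : Measure E3)) hF (measurable_const_smul s)
  rw [Measure.map_addHaar_smul volume hs.ne', lintegral_smul_measure,
    finrank_euclideanSpace_fin] at h
  rw [← h, smul_eq_mul, ← mul_assoc, ← ENNReal.ofReal_mul (by positivity),
    abs_of_pos (by positivity), mul_inv_cancel₀ (by positivity), ENNReal.ofReal_one, one_mul]

lemma lintegral_gaussianDiff_one_div_norm_le {γ : ℝ} (hγ0 : 0 < γ) (hγ2 : γ ≤ 2) {K : ℝ≥0∞}
    (hK : ∀ a : E3, ∫⁻ u : E3, ENNReal.ofReal (gaussianProfile 4 (u + a) / ‖u‖) ≤ K) (v : E3) :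
    ∫⁻ u, ENNReal.ofReal (|gaussianDiff 1 v u| / ‖u‖)
      ≤ ENNReal.ofReal (‖v‖ ^ γ) * (9 * K) := by
  have hm : ∀ a : E3, Measurable
      fun u : E3 => ENNReal.ofReal (gaussianProfile 4 (u + a) / ‖u‖) := fun a => by
    unfold gaussianProfile
    fun_prop
  have hpt : ∀ u : E3, ENNReal.ofReal (|gaussianDiff 1 v u| / ‖u‖) ≤ ENNReal.ofReal (‖v‖ ^ γ) *
      (ENNReal.ofReal (gaussianProfile 4 (u + v) / ‖u‖)
        + ENNReal.ofReal (gaussianProfile 4 (u + -v) / ‖u‖)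
        + 7 * ENNReal.ofReal (gaussianProfile 4 (u + 0) / ‖u‖)) := fun u => by
    have h1 := gaussianProfile_pos 4 (u + v)
    have h2 := gaussianProfile_pos 4 (u + -v)
    have h3 := gaussianProfile_pos 4 (u + 0)
    have h7 : (7 : ℝ≥0∞) = ENNReal.ofReal 7 := by simp
    rw [h7, ← ENNReal.ofReal_mul (by norm_num),
      ← ENNReal.ofReal_add (by positivity) (by positivity),
      ← ENNReal.ofReal_add (by positivity) (by positivity),
      ← ENNReal.ofReal_mul (by positivity)]
    refine ENNReal.ofReal_le_ofReal ?_
    have h := abs_gaussianDiff_one_le hγ0 hγ2 v u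
    calc |gaussianDiff 1 v u| / ‖u‖ ≤ ‖v‖ ^ γ * (gaussianProfile 4 (u + v)
          + gaussianProfile 4 (u + -v) + 7 * gaussianProfile 4 u) / ‖u‖ := by gcongr
      _ = _ := by rw [add_zero]; ring
  refine (lintegral_mono hpt).trans ?_
  rw [lintegral_const_mul' _ _ ENNReal.ofReal_ne_top,
    lintegral_add_left (by exact (hm v).add (hm (-v))), lintegral_add_left (hm v),
    lintegral_const_mul _ (hm 0)]
  gcongr
  calc _ ≤ K + K + 7 * K := by
        gcongr
        exacts [hK v, hK (-v), hK 0]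
    _ = 9 * K := by ring

lemma lintegral_gaussianDiff_div_norm_le {γ : ℝ} (hγ0 : 0 < γ) (hγ2 : γ ≤ 2) {K : ℝ≥0∞}
    (hK : ∀ a : E3, ∫⁻ u : E3, ENNReal.ofReal (gaussianProfile 4 (u + a) / ‖u‖) ≤ K)
    {w : ℝ} (hw : 0 < w) (y : E3) :
    ∫⁻ z, ENNReal.ofReal (|gaussianDiff w y z| / ‖z‖)
      ≤ ENNReal.ofReal (w ^ (1 - γ / 2)) * (ENNReal.ofReal (‖y‖ ^ γ) * (9 * K)) := by
  obtain ⟨s, hs, rfl⟩ : ∃ s : ℝ, 0 < s ∧ s ^ 2 = w :=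
    ⟨√w, Real.sqrt_pos.2 hw, Real.sq_sqrt hw.le⟩
  obtain ⟨v, rfl⟩ : ∃ v : E3, s • v = y := ⟨s⁻¹ • y, smul_inv_smul₀ hs.ne' y⟩
  have hm : Measurable fun z : E3 => ENNReal.ofReal (|gaussianDiff (s ^ 2) (s • v) z| / ‖z‖) := by
    unfold gaussianDiff gaussianProfile
    fun_prop
  rw [lintegral_eq_ofReal_pow_three_mul_lintegral_smul hs hm]
  have hscale : ∀ u : E3,
      ENNReal.ofReal (|gaussianDiff (s ^ 2) (s • v) (s • u)| / ‖s • u‖)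
        = ENNReal.ofReal s⁻¹ * ENNReal.ofReal (|gaussianDiff 1 v u| / ‖u‖) := fun u => by
    rw [gaussianDiff_smul hs, ← ENNReal.ofReal_mul (by positivity), norm_smul,
      Real.norm_of_nonneg hs.le]
    congr 1
    rw [mul_comm s, ← div_div]
    ring
  simp_rw [hscale]
  rw [lintegral_const_mul' _ _ ENNReal.ofReal_ne_top]
  calc ENNReal.ofReal (s ^ 3) * (ENNReal.ofReal s⁻¹ *
        ∫⁻ u, ENNReal.ofReal (|gaussianDiff 1 v u| / ‖u‖))
      ≤ ENNReal.ofReal (s ^ 3) * (ENNReal.ofReal s⁻¹ *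
        (ENNReal.ofReal (‖v‖ ^ γ) * (9 * K))) := by
        gcongr
        exact lintegral_gaussianDiff_one_div_norm_le hγ0 hγ2 hK v
    _ = _ := by
        rw [← mul_assoc, ← mul_assoc, ← mul_assoc (ENNReal.ofReal ((s ^ 2) ^ (1 - γ / 2)))]
        congr 1
        rw [← ENNReal.ofReal_mul (by positivity), ← ENNReal.ofReal_mul (by positivity),
          ← ENNReal.ofReal_mul (by positivity)]
        congr 1
        rw [norm_smul, Real.norm_of_nonneg hs.le, Real.mul_rpow hs.le (norm_nonneg v),
          ← mul_assoc, ← Real.rpow_natCast s 2, ← Real.rpow_mul hs.le, ← Real.rpow_add hs]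
        have : ((2 : ℕ) : ℝ) * (1 - γ / 2) + γ = ((2 : ℕ) : ℝ) := by push_cast; ring
        rw [this, Real.rpow_natCast]
        field_simp

lemma integrableOn_besselIntegrand {α : ℝ} (hα : 1 < α) {x : E3} (hx : x ≠ 0) :
    IntegrableOn (fun w : ℝ => w ^ ((α - 5) / 2) * Real.exp (-w) * gaussianProfile w x)
      (Set.Ioi 0) := by
  have hr : 0 < ‖x‖ := norm_pos_iff.2 hx
  have hG := (Real.GammaIntegral_convergent (s := (α - 5) / 2 + 3) (by linarith)).const_mul
    (32 / ‖x‖ ^ 4)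
  refine hG.mono' ?_ ?_
  · unfold gaussianProfile
    exact Measurable.aestronglyMeasurable (by fun_prop)
  · refine (ae_restrict_iff' measurableSet_Ioi).2 (Filter.Eventually.of_forall fun w hw => ?_)
    have hw : 0 < w := hw
    have hp := gaussianProfile_pos w x
    rw [Real.norm_of_nonneg (by positivity)]
    have hexp : gaussianProfile w x ≤ 32 / ‖x‖ ^ 4 * w ^ 2 := by
      have h := Real.quadratic_le_exp_of_nonneg (x := ‖x‖ ^ 2 / (4 * w)) (by positivity)
      have h2 : (‖x‖ ^ 2 / (4 * w)) ^ 2 / 2 ≤ Real.exp (‖x‖ ^ 2 / (4 * w)) := by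
        have : 0 ≤ ‖x‖ ^ 2 / (4 * w) := by positivity
        linarith
      unfold gaussianProfile
      rw [neg_div, Real.exp_neg]
      calc (Real.exp (‖x‖ ^ 2 / (4 * w)))⁻¹ ≤ ((‖x‖ ^ 2 / (4 * w)) ^ 2 / 2)⁻¹ := by gcongr
        _ = 32 / ‖x‖ ^ 4 * w ^ 2 := by field_simp; norm_num
    calc w ^ ((α - 5) / 2) * Real.exp (-w) * gaussianProfile w x
        ≤ w ^ ((α - 5) / 2) * Real.exp (-w) * (32 / ‖x‖ ^ 4 * w ^ 2) := by gcongr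
      _ = 32 / ‖x‖ ^ 4 * (Real.exp (-w) * w ^ ((α - 5) / 2 + 3 - 1)) := by
        rw [show (α - 5) / 2 + 3 - 1 = (α - 5) / 2 + 2 by ring, Real.rpow_add hw, Real.rpow_two]
        ring

lemma ofReal_abs_besselKernel_diff_le {α : ℝ} (hα : 1 < α) {y z : E3} (h0 : z ≠ 0)
    (h1 : z + y ≠ 0) (h2 : z - y ≠ 0) :
    ENNReal.ofReal
        |besselKernel α (z + y) + besselKernel α (z - y) - 2 * besselKernel α z|
      ≤ ∫⁻ w in Set.Ioi (0 : ℝ), ENNReal.ofReal (w ^ ((α - 5) / 2) * Real.exp (-w))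
          * ENNReal.ofReal |gaussianDiff w y z| := by
  have i0 := integrableOn_besselIntegrand hα h0
  have i1 := integrableOn_besselIntegrand hα h1
  have i2 := integrableOn_besselIntegrand hα h2
  have hdiff : besselKernel α (z + y) + besselKernel α (z - y) - 2 * besselKernel α z
      = ∫ w in Set.Ioi (0 : ℝ), w ^ ((α - 5) / 2) * Real.exp (-w) * gaussianDiff w y z := by
    unfold besselKernel
    simp only [← gaussianProfile.eq_1]
    rw [← integral_add i1 i2, ← integral_const_mul,
      ← integral_sub (by exact i1.add i2) (i0.const_mul 2)]
    refine integral_congr_ae (Filter.Eventually.of_forall fun w => ?_)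
    simp only [gaussianDiff]
    ring
  rw [hdiff, ← Real.norm_eq_abs, ofReal_norm]
  refine (enorm_integral_le_lintegral_enorm _).trans ?_
  refine setLIntegral_mono' measurableSet_Ioi fun w hw => ?_
  have hw : 0 < w := hw
  rw [← ofReal_norm, Real.norm_eq_abs, abs_mul, abs_of_nonneg (by positivity),
    ENNReal.ofReal_mul (by positivity)]

/-- Proposition 5.3, condition (3.2) for the Bessel kernel: for `α > 1` and
`0 < γ' < min(α-1, 2)` there is `C > 0` such that for all `y ∈ ℝ³`,
`∫_{|z| ≤ 2T} |f(z+y) + f(z-y) - 2f(z)| / |z| dz ≤ C |y|^{γ'}`. -/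
theorem bessel_second_difference
    (α T γ' : ℝ) (hα : 1 < α) (hT : 0 < T)
    (hγ0 : 0 < γ') (hγ : γ' < min (α - 1) 2) :
    ∃ C : ℝ, 0 < C ∧ ∀ y : E3,
      (∫⁻ z in Metric.closedBall (0 : E3) (2 * T),
          ENNReal.ofReal
            (|besselKernel α (z + y) + besselKernel α (z - y) - 2 * besselKernel α z| / ‖z‖))
        ≤ ENNReal.ofReal (C * ‖y‖ ^ γ') := by
  have hγα : γ' < α - 1 := hγ.trans_le (min_le_left _ _)
  have hγ2 : γ' ≤ 2 := (hγ.trans_le (min_le_right _ _)).le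
  obtain ⟨K, hKtop, hK⟩ := exists_lintegral_gaussianProfile_div_norm_le
  set M : ℝ≥0∞ := ∫⁻ w in Set.Ioi (0 : ℝ),
    ENNReal.ofReal (Real.exp (-w) * w ^ ((α - 1 - γ') / 2 - 1)) with hM
  have hMtop : M ≠ ∞ :=
    (Real.GammaIntegral_convergent (s := (α - 1 - γ') / 2) (by linarith)).lintegral_lt_top.ne
  have hPtop : M * (9 * K) ≠ ∞ :=
    ENNReal.mul_ne_top hMtop (ENNReal.mul_ne_top (by norm_num) hKtop)
  refine ⟨(M * (9 * K)).toReal + 1, by positivity, fun y => ?_⟩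
  have hae : ∀ᵐ z : E3, ENNReal.ofReal
      (|besselKernel α (z + y) + besselKernel α (z - y) - 2 * besselKernel α z| / ‖z‖)
      ≤ ∫⁻ w in Set.Ioi (0 : ℝ), ENNReal.ofReal (w ^ ((α - 5) / 2) * Real.exp (-w))
          * ENNReal.ofReal (|gaussianDiff w y z| / ‖z‖) := by
    filter_upwards [Measure.ae_ne volume (0 : E3), Measure.ae_ne volume (-y),
      Measure.ae_ne volume y] with z h0 h1 h2
    have h := ofReal_abs_besselKernel_diff_le hα h0
      (fun h => h1 (eq_neg_of_add_eq_zero_left h)) (sub_ne_zero.2 h2)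
    simp only [div_eq_mul_inv, ENNReal.ofReal_mul (abs_nonneg _), ← mul_assoc]
    rw [lintegral_mul_const' _ _ ENNReal.ofReal_ne_top]
    gcongr
    simpa only [div_eq_mul_inv] using h
  have hmeas : Measurable (Function.uncurry fun (z : E3) (w : ℝ) =>
      ENNReal.ofReal (w ^ ((α - 5) / 2) * Real.exp (-w))
        * ENNReal.ofReal (|gaussianDiff w y z| / ‖z‖)) := by
    unfold gaussianDiff gaussianProfile Function.uncurry
    fun_prop
  calc _ ≤ ∫⁻ z, ENNReal.ofReal
        (|besselKernel α (z + y) + besselKernel α (z - y) - 2 * besselKernel α z| / ‖z‖) :=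
        setLIntegral_le_lintegral _ _
    _ ≤ _ := lintegral_mono_ae hae
    _ = _ := lintegral_lintegral_swap hmeas.aemeasurable
    _ ≤ ∫⁻ w in Set.Ioi (0 : ℝ), ENNReal.ofReal (Real.exp (-w) * w ^ ((α - 1 - γ') / 2 - 1))
          * (ENNReal.ofReal (‖y‖ ^ γ') * (9 * K)) := by
        refine setLIntegral_mono' measurableSet_Ioi fun w hw => ?_
        have hw : 0 < w := hw
        rw [lintegral_const_mul' _ _ ENNReal.ofReal_ne_top]
        grw [lintegral_gaussianDiff_div_norm_le hγ0 hγ2 hK hw y]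
        rw [← mul_assoc, ← ENNReal.ofReal_mul (by positivity)]
        refine le_of_eq ?_
        congr 2
        rw [show (α - 1 - γ') / 2 - 1 = (α - 5) / 2 + (1 - γ' / 2) by ring, Real.rpow_add hw]
        ring
    _ = M * (9 * K) * ENNReal.ofReal (‖y‖ ^ γ') := by
        rw [lintegral_mul_const' _ _
          (ENNReal.mul_ne_top ENNReal.ofReal_ne_top (ENNReal.mul_ne_top (by norm_num) hKtop)), ← hM]
        ring
    _ ≤ _ := by
        rw [ENNReal.ofReal_mul (by positivity)]
        gcongr
        exact (ENNReal.le_ofReal_iff_toReal_le hPtop (by positivity)).2 (by linarith)
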